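/- Fix α ∈ (0,1). If Λ : [0,∞) → [0,1] is nonincreasing, right-continuous, and satisfies ∫₀^∞ (1+t)^{−2} Λ(θt) dt = c(θ) for every θ > 0, then Λ = Λ⁰; that is, the arcsine distribution function is the unique such solution of this integral equation. -/

import Mathlib

open MeasureTheory Set Filter

/-- The distribution function of the generalized arcsine law with parameter `α`. -/
noncomputable def arcsineCDF (α u : ℝ) : ℝ :=
  (Real.sin (Real.pi * α) / Real.pi) *
    ∫ s in Set.Ioo (u / (1 + u)) 1, s ^ (-α) * (1 - s) ^ (α - 1)

/-- The function `c(θ)` of the paper. -/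
noncomputable def cFun (α θ : ℝ) : ℝ :=
  (∫ w in Set.Ioi (0:ℝ), (w / (1 + w)) * (w / (θ + w)) * w ^ (-1 - α)) /
    (∫ w in Set.Ioi (0:ℝ), (w / (1 + w)) * w ^ (-1 - α))


theorem integrableOn_arcsineKernel {α : ℝ} (hα : α ∈ Ioo (0:ℝ) 1) :
    IntegrableOn (fun s : ℝ => s ^ (-α) * (1 - s) ^ (α - 1)) (Ioo 0 1) := by
  have h := (Complex.betaIntegral_convergent (u := ((1 - α : ℝ) : ℂ)) (v := (α : ℂ))
    (by simpa using hα.2) (by simpa using hα.1)).1.mono_set Ioo_subset_Ioc_self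
  refine IntegrableOn.congr_fun (Integrable.re h) (fun s hs => ?_) measurableSet_Ioo
  have h1 : ((1 - α : ℝ) : ℂ) - 1 = ((-α : ℝ) : ℂ) := by push_cast; ring
  have h2 : (α : ℂ) - 1 = ((α - 1 : ℝ) : ℂ) := by push_cast; ring
  have h3 : (1 : ℂ) - s = ((1 - s : ℝ) : ℂ) := by push_cast; ring
  simp only [h1, h2, h3, ← Complex.ofReal_cpow hs.1.le,
    ← Complex.ofReal_cpow (sub_nonneg.2 hs.2.le), ← Complex.ofReal_mul]
  simp

theorem integral_arcsineKernel {α : ℝ} (hα : α ∈ Ioo (0:ℝ) 1) :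
    ∫ s in Ioo (0:ℝ) 1, s ^ (-α) * (1 - s) ^ (α - 1) = Real.pi / Real.sin (Real.pi * α) := by
  have h := Complex.Gamma_mul_Gamma_eq_betaIntegral (s := ((1 - α : ℝ) : ℂ)) (t := (α : ℂ))
    (by simpa using hα.2) (by simpa using hα.1)
  have h0 : ((1 - α : ℝ) : ℂ) + α = 1 := by push_cast; ring
  have h1 : ((1 - α : ℝ) : ℂ) - 1 = ((-α : ℝ) : ℂ) := by push_cast; ring
  have h2 : (α : ℂ) - 1 = ((α - 1 : ℝ) : ℂ) := by push_cast; ring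
  have hint : Complex.betaIntegral ((1 - α : ℝ) : ℂ) α =
      ((∫ s in Ioo (0:ℝ) 1, s ^ (-α) * (1 - s) ^ (α - 1) : ℝ) : ℂ) := by
    rw [Complex.betaIntegral, intervalIntegral.integral_of_le zero_le_one,
      integral_Ioc_eq_integral_Ioo, ← integral_complex_ofReal]
    refine setIntegral_congr_fun measurableSet_Ioo fun s hs => ?_
    have h3 : (1 : ℂ) - s = ((1 - s : ℝ) : ℂ) := by push_cast; ring
    simp only [h1, h2, h3, ← Complex.ofReal_cpow hs.1.le,
      ← Complex.ofReal_cpow (sub_nonneg.2 hs.2.le), ← Complex.ofReal_mul]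
  rw [h0, Complex.Gamma_one, one_mul, hint, Complex.Gamma_ofReal, Complex.Gamma_ofReal,
    ← Complex.ofReal_mul, Complex.ofReal_inj] at h
  rw [← h, mul_comm, Real.Gamma_mul_Gamma_one_sub]

/-- If `∫ D(x) (1 - εx)⁻² dx` vanishes for every `ε < 1`, then so do all moments of `D`. -/
theorem integral_mul_pow_eq_zero_of_transform_eq_zero {D : ℝ → ℝ} (hD : IntegrableOn D (Ioo 0 1))
    (h : ∀ ε < 1, ∫ x in Ioo (0:ℝ) 1, D x * ((1 - ε * x) ^ 2)⁻¹ = 0) (n : ℕ) :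
    ∫ x in Ioo (0:ℝ) 1, D x * x ^ n = 0 := by
  suffices H : ∀ n : ℕ, ∀ ε ∈ Ioo (-1 : ℝ) (1 / 2),
      ∫ x in Ioo (0:ℝ) 1, D x * (x ^ n * ((1 - ε * x) ^ (n + 2))⁻¹) = 0 by
    simpa using H n 0 (by norm_num)
  intro n
  induction n with
  | zero => intro ε hε; simpa using h ε (by linarith [hε.2])
  | succ n ih =>
    intro ε hε
    have hlb : ∀ x ∈ Ioo (0:ℝ) 1, ∀ e ∈ Ioo (-1 : ℝ) (1 / 2), 1 / 2 ≤ 1 - e * x := by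
      intro x hx e he
      nlinarith [hx.1, hx.2, he.1, he.2]
    have hbd : ∀ k m : ℕ, ∀ x ∈ Ioo (0:ℝ) 1, ∀ e ∈ Ioo (-1 : ℝ) (1 / 2),
        ‖x ^ k * ((1 - e * x) ^ m)⁻¹‖ ≤ 2 ^ m := by
      intro k m x hx e he
      have h1 := hlb x hx e he
      have h2 : ((1 - e * x) ^ m)⁻¹ ≤ 2 ^ m := by
        rw [← inv_pow]
        refine pow_le_pow_left₀ (by positivity) ?_ _
        rw [inv_le_comm₀ (by linarith) (by norm_num)]
        linarith
      rw [norm_mul, Real.norm_of_nonneg (pow_nonneg hx.1.le _),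
        Real.norm_of_nonneg (inv_nonneg.2 (pow_nonneg (by linarith) _))]
      calc x ^ k * ((1 - e * x) ^ m)⁻¹ ≤ 1 * 2 ^ m := by
            refine mul_le_mul (pow_le_one₀ hx.1.le hx.2.le) h2
              (inv_nonneg.2 (pow_nonneg (by linarith) _)) zero_le_one
        _ = 2 ^ m := one_mul _
    have hint : ∀ k m : ℕ, ∀ e ∈ Ioo (-1 : ℝ) (1 / 2),
        IntegrableOn (fun x => D x * (x ^ k * ((1 - e * x) ^ m)⁻¹)) (Ioo 0 1) := by
      intro k m e he
      refine Integrable.mul_bdd (c := 2 ^ m) hD (by fun_prop) ?_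
      filter_upwards [ae_restrict_mem measurableSet_Ioo] with x hx using hbd k m x hx e he
    have key := (hasDerivAt_integral_of_dominated_loc_of_deriv_le
      (μ := volume.restrict (Ioo (0:ℝ) 1)) (x₀ := ε) (s := Ioo (-1 : ℝ) (1 / 2))
      (F := fun e x => D x * (x ^ n * ((1 - e * x) ^ (n + 2))⁻¹))
      (F' := fun e x => (n + 2) * (D x * (x ^ (n + 1) * ((1 - e * x) ^ (n + 1 + 2))⁻¹)))
      (bound := fun x => (n + 2) * (‖D x‖ * 2 ^ (n + 1 + 2)))
      (Ioo_mem_nhds hε.1 hε.2)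
      (by filter_upwards [Ioo_mem_nhds hε.1 hε.2] with e he using (hint _ _ e he).1)
      (hint _ _ ε hε) ((hint _ _ ε hε).const_mul _).1
      (by
        filter_upwards [ae_restrict_mem measurableSet_Ioo] with x hx e he
        rw [norm_mul, norm_mul, Real.norm_of_nonneg (by positivity : (0:ℝ) ≤ n + 2)]
        gcongr
        exact hbd _ _ x hx e he)
      ((hD.norm.mul_const _).const_mul _)
      (by
        filter_upwards [ae_restrict_mem measurableSet_Ioo] with x hx e he
        have h1 := hlb x hx e he
        have h0 : (1 - e * x) ≠ 0 := by linarith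
        have hd : HasDerivAt (fun e : ℝ => 1 - e * x) (-x) e := by
          simpa using ((hasDerivAt_id e).mul_const x).const_sub 1
        refine ((((hd.pow (n + 2)).inv (pow_ne_zero _ h0)).const_mul (x ^ n)).const_mul
          (D x)).congr_deriv ?_
        simp only [Pi.pow_apply]
        rw [show n + 2 - 1 = n + 1 from rfl]
        push_cast
        field_simp
        ring)).2
    have hz : HasDerivAt (fun e => ∫ x in Ioo (0:ℝ) 1, D x * (x ^ n * ((1 - e * x) ^ (n + 2))⁻¹))
        0 ε := by
      refine (hasDerivAt_const ε (0:ℝ)).congr_of_eventuallyEq ?_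
      filter_upwards [Ioo_mem_nhds hε.1 hε.2] with e he using ih e he
    have := key.unique hz
    rw [integral_const_mul] at this
    exact (mul_eq_zero.1 this).resolve_left (by positivity)

/-- An integrable function on `(0, 1)` all of whose moments vanish is zero a.e. -/
theorem ae_eq_zero_of_integral_mul_pow_eq_zero {D : ℝ → ℝ} (hD : IntegrableOn D (Ioo 0 1))
    (h : ∀ n : ℕ, ∫ x in Ioo (0:ℝ) 1, D x * x ^ n = 0) :
    ∀ᵐ x, x ∈ Ioo (0:ℝ) 1 → D x = 0 := by
  have hpow : ∀ n : ℕ, IntegrableOn (fun x => D x * x ^ n) (Ioo 0 1) := by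
    intro n
    refine Integrable.mul_bdd (c := 1) hD (by fun_prop) ?_
    filter_upwards [ae_restrict_mem measurableSet_Ioo] with x hx
    rw [norm_pow, Real.norm_of_nonneg hx.1.le]
    exact pow_le_one₀ hx.1.le hx.2.le
  have hpoly_eq : ∀ p : Polynomial ℝ, (fun x => D x * p.eval x) =
      fun x => ∑ i ∈ Finset.range (p.natDegree + 1), p.coeff i * (D x * x ^ i) := by
    intro p
    ext x
    rw [Polynomial.eval_eq_sum_range, Finset.mul_sum]
    exact Finset.sum_congr rfl fun i _ => by ring
  have hpoly : ∀ p : Polynomial ℝ, IntegrableOn (fun x => D x * p.eval x) (Ioo 0 1) ∧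
      ∫ x in Ioo (0:ℝ) 1, D x * p.eval x = 0 := by
    intro p
    rw [hpoly_eq]
    refine ⟨integrable_finsetSum _ fun i _ => (hpow i).const_mul _, ?_⟩
    rw [integral_finsetSum _ fun i _ => (hpow i).const_mul _]
    exact Finset.sum_eq_zero fun i _ => by rw [integral_const_mul, h, mul_zero]
  refine isOpen_Ioo.ae_eq_zero_of_integral_contDiff_smul_eq_zero hD.locallyIntegrableOn
    fun g hg hgc hgs => ?_
  have hg_cont : Continuous g := hg.continuous
  obtain ⟨C, hC⟩ := hgc.exists_bound_of_continuous hg_cont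
  have hgD : IntegrableOn (fun x => D x * g x) (Ioo 0 1) :=
    Integrable.mul_bdd (c := C) hD hg_cont.aestronglyMeasurable (ae_of_all _ hC)
  have hset : ∫ x, g x • D x = ∫ x in Ioo (0:ℝ) 1, D x * g x := by
    rw [← setIntegral_eq_integral_of_forall_compl_eq_zero (s := Ioo (0:ℝ) 1)]
    · simp only [smul_eq_mul, mul_comm]
    · intro x hx
      rw [image_eq_zero_of_notMem_tsupport fun hx' => hx (hgs hx'), zero_smul]
  rw [hset, ← norm_eq_zero]
  refine le_antisymm (le_of_forall_pos_le_add fun δ hδ => ?_) (norm_nonneg _)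
  set I := ∫ x in Ioo (0:ℝ) 1, ‖D x‖ with hI
  have hI0 : 0 ≤ I := integral_nonneg fun _ => norm_nonneg _
  obtain ⟨p, hp⟩ := exists_polynomial_near_of_continuousOn 0 1 g hg_cont.continuousOn
    (δ / (I + 1)) (by positivity)
  calc ‖∫ x in Ioo (0:ℝ) 1, D x * g x‖
      = ‖∫ x in Ioo (0:ℝ) 1, (D x * g x - D x * p.eval x)‖ := by
        rw [integral_sub hgD (hpoly p).1, (hpoly p).2, sub_zero]
    _ ≤ ∫ x in Ioo (0:ℝ) 1, ‖D x‖ * (δ / (I + 1)) := by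
        refine norm_integral_le_of_norm_le (hD.norm.mul_const _) ?_
        filter_upwards [ae_restrict_mem measurableSet_Ioo] with x hx
        rw [← mul_sub, norm_mul]
        gcongr
        rw [norm_sub_rev]
        exact (hp x (Ioo_subset_Icc_self hx)).le
    _ = I * (δ / (I + 1)) := by rw [integral_mul_const]
    _ ≤ 0 + δ := by
        rw [mul_div_assoc', div_le_iff₀ (by positivity)]
        nlinarith

theorem image_one_sub_div_mul {θ : ℝ} (hθ : 0 < θ) :
    (fun x : ℝ => (1 - x) / (θ * x)) '' Ioo 0 1 = Ioi 0 := by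
  ext t
  constructor
  · rintro ⟨x, hx, rfl⟩
    exact div_pos (sub_pos.2 hx.2) (mul_pos hθ hx.1)
  · intro ht
    have ht : 0 < t := ht
    have hpos : 0 < 1 + θ * t := by positivity
    refine ⟨1 / (1 + θ * t), ⟨by positivity, ?_⟩, ?_⟩
    · rw [div_lt_one hpos]
      linarith [mul_pos hθ ht]
    · simp only
      field_simp
      ring

/-- The change of variables `t = (1 - x) / (θ x)`. -/
theorem integral_Ioi_eq_integral_Ioo_unit {θ : ℝ} (hθ : 0 < θ) (Λ : ℝ → ℝ) :
    ∫ t in Ioi (0:ℝ), ((1 + t) ^ 2)⁻¹ * Λ (θ * t) =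
      θ * ∫ x in Ioo (0:ℝ) 1, Λ ((1 - x) / x) * ((1 - (1 - θ) * x) ^ 2)⁻¹ := by
  rw [← image_one_sub_div_mul hθ, integral_image_eq_integral_abs_deriv_smul
    (f' := fun x => -(θ * x ^ 2)⁻¹) measurableSet_Ioo, ← integral_const_mul]
  · refine setIntegral_congr_fun measurableSet_Ioo fun x hx => ?_
    have hx0 : x ≠ 0 := hx.1.ne'
    have h1 : 1 - (1 - θ) * x ≠ 0 := by nlinarith [mul_pos hθ hx.1, hx.2]
    have h2 : θ * ((1 - x) / (θ * x)) = (1 - x) / x := by field_simp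
    have h3 : 1 + (1 - x) / (θ * x) = (1 - (1 - θ) * x) / (θ * x) := by field_simp; ring
    simp only [smul_eq_mul]
    rw [h2, h3, abs_neg, abs_of_nonneg (by positivity)]
    field_simp
  · intro x hx
    have hx0 : x ≠ 0 := hx.1.ne'
    refine HasDerivAt.hasDerivWithinAt ?_
    refine (((hasDerivAt_id x).const_sub 1).div ((hasDerivAt_id x).const_mul θ)
      (mul_ne_zero hθ.ne' hx0)).congr_deriv ?_
    simp only [id]
    field_simp
    ring
  · intro x hx y hy hxy
    have hx0 : x ≠ 0 := hx.1.ne'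
    have hy0 : y ≠ 0 := hy.1.ne'
    simp only at hxy
    field_simp at hxy
    linarith

theorem image_div_one_sub : (fun s : ℝ => s / (1 - s)) '' Ioo 0 1 = Ioi 0 := by
  ext w
  constructor
  · rintro ⟨s, hs, rfl⟩
    exact div_pos hs.1 (sub_pos.2 hs.2)
  · intro hw
    have hw : 0 < w := hw
    refine ⟨w / (1 + w), ⟨by positivity, ?_⟩, ?_⟩
    · rw [div_lt_one (by positivity)]
      linarith
    · simp only
      rw [one_sub_div (by positivity)]
      field_simp
      ring

/-- The change of variables `w = s / (1 - s)`. -/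
theorem integral_Ioi_mul_rpow_eq_integral_arcsineKernel (α : ℝ) (g : ℝ → ℝ) :
    ∫ w in Ioi (0:ℝ), (w / (1 + w)) * g w * w ^ (-1 - α) =
      ∫ s in Ioo (0:ℝ) 1, s ^ (-α) * (1 - s) ^ (α - 1) * g (s / (1 - s)) := by
  rw [← image_div_one_sub, integral_image_eq_integral_abs_deriv_smul
    (f' := fun s => ((1 - s) ^ 2)⁻¹) measurableSet_Ioo]
  · refine setIntegral_congr_fun measurableSet_Ioo fun s hs => ?_
    have hs0 : 0 < s := hs.1
    have hs1 : 0 < 1 - s := sub_pos.2 hs.2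
    have h1 : s / (1 - s) / (1 + s / (1 - s)) = s := by field_simp; ring
    have h2 : s ^ (-α) = s * s ^ (-1 - α) := by
      rw [mul_comm, ← Real.rpow_add_one hs0.ne']
      ring_nf
    have h3 : (1 - s) ^ (α - 1) = ((1 - s) ^ 2)⁻¹ * ((1 - s) ^ (-1 - α))⁻¹ := by
      rw [← Real.rpow_neg hs1.le, ← Real.rpow_natCast, ← Real.rpow_neg hs1.le,
        ← Real.rpow_add hs1]
      norm_num
      ring_nf
    simp only [smul_eq_mul]
    rw [h1, Real.div_rpow hs0.le hs1.le, h2, h3, abs_of_nonneg (by positivity)]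
    ring
  · intro s hs
    have hs1 : 1 - s ≠ 0 := (sub_pos.2 hs.2).ne'
    refine HasDerivAt.hasDerivWithinAt ?_
    refine ((hasDerivAt_id s).div ((hasDerivAt_id s).const_sub 1) hs1).congr_deriv ?_
    simp only [id]
    field_simp
    ring
  · intro x hx y hy hxy
    have hx1 : 1 - x ≠ 0 := (sub_pos.2 hx.2).ne'
    have hy1 : 1 - y ≠ 0 := (sub_pos.2 hy.2).ne'
    simp only at hxy
    field_simp at hxy
    linarith

theorem cFun_eq_integral_arcsineKernel {α : ℝ} (hα : α ∈ Ioo (0:ℝ) 1) (θ : ℝ) :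
    cFun α θ = Real.sin (Real.pi * α) / Real.pi *
      ∫ s in Ioo (0:ℝ) 1, s ^ (-α) * (1 - s) ^ (α - 1) * (s / (θ * (1 - s) + s)) := by
  have hden := integral_Ioi_mul_rpow_eq_integral_arcsineKernel α fun _ => 1
  simp only [mul_one] at hden
  rw [cFun, hden, integral_arcsineKernel hα,
    integral_Ioi_mul_rpow_eq_integral_arcsineKernel α fun w => w / (θ + w), div_div_eq_mul_div,
    mul_div_assoc, mul_comm]
  congr 1
  refine setIntegral_congr_fun measurableSet_Ioo fun s hs => ?_
  have hs1 : 1 - s ≠ 0 := (sub_pos.2 hs.2).ne'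
  congr 1
  rw [← mul_div_mul_right _ _ hs1, add_mul, div_mul_cancel₀ _ hs1]

theorem integral_inv_sq_one_sub_mul {θ s : ℝ} (hθ : 0 < θ) (hs : s ∈ Ioo (0:ℝ) 1) :
    θ * ∫ x in Ioo (1 - s) 1, ((1 - (1 - θ) * x) ^ 2)⁻¹ = s / (θ * (1 - s) + s) := by
  have hpos : ∀ x ∈ Icc (1 - s) 1, 0 < 1 - (1 - θ) * x := by
    intro x hx
    nlinarith [mul_pos hθ (lt_of_lt_of_le (sub_pos.2 hs.2) hx.1), hx.2]
  have hle : 1 - s ≤ 1 := by linarith [hs.1]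
  rw [← integral_Ioc_eq_integral_Ioo, ← intervalIntegral.integral_of_le hle,
    intervalIntegral.integral_eq_sub_of_hasDerivAt (f := fun x => x / (1 - (1 - θ) * x))]
  · have h1 := hpos (1 - s) (left_mem_Icc.2 hle)
    have h2 : θ * (1 - s) + s = 1 - (1 - θ) * (1 - s) := by ring
    rw [h2, show (1:ℝ) - (1 - θ) * 1 = θ by ring, mul_sub, mul_one_div_cancel hθ.ne',
      mul_div_assoc', one_sub_div h1.ne']
    ring
  · intro x hx
    rw [uIcc_of_le hle] at hx
    have h1 := (hpos x hx).ne'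
    have hd : HasDerivAt (fun x : ℝ => 1 - (1 - θ) * x) (-(1 - θ)) x := by
      simpa using ((hasDerivAt_id x).const_mul (1 - θ)).const_sub 1
    refine ((hasDerivAt_id x).div hd h1).congr_deriv ?_
    simp only [id]
    field_simp
    ring
  · refine ContinuousOn.intervalIntegrable ?_
    rw [uIcc_of_le hle]
    exact ContinuousOn.inv₀ (by fun_prop) fun x hx => pow_ne_zero _ (hpos x hx).ne'

theorem one_sub_mul_lower_bound {θ x : ℝ} (hx : x ∈ Ioo (0:ℝ) 1) :
    min 1 θ ≤ 1 - (1 - θ) * x := by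
  rcases le_total 1 θ with h | h
  · rw [min_eq_left h]
    nlinarith [hx.1]
  · rw [min_eq_right h]
    nlinarith [hx.2]

theorem integrableOn_mul_inv_sq {θ : ℝ} (hθ : 0 < θ) {G : ℝ → ℝ} (hG : IntegrableOn G (Ioo 0 1)) :
    IntegrableOn (fun x => G x * ((1 - (1 - θ) * x) ^ 2)⁻¹) (Ioo 0 1) := by
  have hm : 0 < min 1 θ := lt_min one_pos hθ
  refine Integrable.mul_bdd (c := (min 1 θ ^ 2)⁻¹) hG (by fun_prop) ?_
  filter_upwards [ae_restrict_mem measurableSet_Ioo] with x hx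
  have := one_sub_mul_lower_bound (θ := θ) hx
  rw [norm_inv, norm_pow, Real.norm_of_nonneg (hm.le.trans this)]
  gcongr

theorem arcsineCDF_one_sub_div {α x : ℝ} (hx : 0 < x) :
    arcsineCDF α ((1 - x) / x) = Real.sin (Real.pi * α) / Real.pi *
      ∫ s in Ioo (1 - x) 1, s ^ (-α) * (1 - s) ^ (α - 1) := by
  have : (1 - x) / x / (1 + (1 - x) / x) = 1 - x := by field_simp; ring
  rw [arcsineCDF, this]

/-- The arcsine distribution function solves the integral equation, in the variable
`x = 1 / (1 + u)`. -/
theorem integral_arcsineCDF_mul_inv_sq {α : ℝ} (hα : α ∈ Ioo (0:ℝ) 1) {θ : ℝ} (hθ : 0 < θ) :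
    θ * ∫ x in Ioo (0:ℝ) 1, arcsineCDF α ((1 - x) / x) * ((1 - (1 - θ) * x) ^ 2)⁻¹ =
      cFun α θ := by
  set k : ℝ → ℝ := fun s => s ^ (-α) * (1 - s) ^ (α - 1) with hk
  set h : ℝ → ℝ := fun x => ((1 - (1 - θ) * x) ^ 2)⁻¹ with hh
  set T : Set (ℝ × ℝ) := {p | 1 - p.1 < p.2} with hT
  have hTm : MeasurableSet T := measurableSet_lt (by fun_prop) (by fun_prop)
  have hk_int : IntegrableOn k (Ioo 0 1) := integrableOn_arcsineKernel hα
  have hh_int : IntegrableOn h (Ioo 0 1) := by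
    simpa using integrableOn_mul_inv_sq hθ (G := fun _ => 1) (integrableOn_const (by simp))
  have hprod : Integrable (T.indicator fun p : ℝ × ℝ => h p.1 * k p.2)
      ((volume.restrict (Ioo (0:ℝ) 1)).prod (volume.restrict (Ioo (0:ℝ) 1))) :=
    (hh_int.mul_prod hk_int).indicator hTm
  have hswap := integral_integral_swap (f := fun x s => T.indicator (fun p => h p.1 * k p.2) (x, s))
    hprod
  have hleft : ∀ x ∈ Ioo (0:ℝ) 1,
      ∫ s in Ioo (0:ℝ) 1, T.indicator (fun p => h p.1 * k p.2) (x, s) =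
        h x * ∫ s in Ioo (1 - x) 1, k s := by
    intro x hx
    have : ∀ s, T.indicator (fun p => h p.1 * k p.2) (x, s) =
        (Ioi (1 - x)).indicator (fun s => h x * k s) s := fun s => rfl
    simp only [this]
    rw [setIntegral_indicator measurableSet_Ioi, Ioo_inter_Ioi,
      sup_of_le_right (sub_nonneg.2 hx.2.le), integral_const_mul]
  have hright : ∀ s ∈ Ioo (0:ℝ) 1,
      ∫ x in Ioo (0:ℝ) 1, T.indicator (fun p => h p.1 * k p.2) (x, s) =
        (∫ x in Ioo (1 - s) 1, h x) * k s := by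
    intro s hs
    have : ∀ x, T.indicator (fun p => h p.1 * k p.2) (x, s) =
        (Ioi (1 - s)).indicator (fun x => h x * k s) x := by
      intro x
      simp only [indicator, hT, mem_ofPred_eq, mem_Ioi, sub_lt_comm]
    simp only [this]
    rw [setIntegral_indicator measurableSet_Ioi, Ioo_inter_Ioi,
      sup_of_le_right (sub_nonneg.2 hs.2.le), integral_mul_const]
  rw [setIntegral_congr_fun measurableSet_Ioo hleft,
    setIntegral_congr_fun measurableSet_Ioo hright] at hswap
  have hL : ∫ x in Ioo (0:ℝ) 1, arcsineCDF α ((1 - x) / x) * h x =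
      Real.sin (Real.pi * α) / Real.pi * ∫ x in Ioo (0:ℝ) 1, h x * ∫ s in Ioo (1 - x) 1, k s := by
    rw [← integral_const_mul]
    refine setIntegral_congr_fun measurableSet_Ioo fun x hx => ?_
    rw [arcsineCDF_one_sub_div hx.1]
    ring
  rw [hL, hswap, cFun_eq_integral_arcsineKernel hα, mul_left_comm, ← integral_const_mul]
  congr 1
  refine setIntegral_congr_fun measurableSet_Ioo fun s hs => ?_
  rw [← integral_inv_sq_one_sub_mul hθ hs]
  ring

theorem continuousOn_integral_arcsineKernel {α : ℝ} (hα : α ∈ Ioo (0:ℝ) 1) :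
    ContinuousOn (fun x => ∫ s in Ioo (1 - x) 1, s ^ (-α) * (1 - s) ^ (α - 1)) (Icc (0:ℝ) 1) := by
  set k : ℝ → ℝ := fun s => s ^ (-α) * (1 - s) ^ (α - 1) with hk
  have hk_int : IntegrableOn k (uIcc 1 0) := by
    rw [uIcc_of_ge zero_le_one, integrableOn_Icc_iff_integrableOn_Ioo]
    exact integrableOn_arcsineKernel hα
  have hc := intervalIntegral.continuousOn_primitive_interval' (b₁ := 1) (b₂ := 0) (a := 1) (f := k)
    (μ := volume) hk_int.intervalIntegrable left_mem_uIcc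
  rw [uIcc_of_ge zero_le_one] at hc
  have hmap : MapsTo (fun x : ℝ => 1 - x) (Icc 0 1) (Icc 0 1) :=
    fun x hx => ⟨by linarith [hx.2], by linarith [hx.1]⟩
  refine (hc.comp (by fun_prop) hmap).neg.congr fun x hx => ?_
  have hx1 : 1 - x ≤ 1 := by linarith [hx.1]
  simp only [Function.comp, Pi.neg_apply]
  rw [← intervalIntegral.integral_symm, intervalIntegral.integral_of_le hx1,
    integral_Ioc_eq_integral_Ioo]

theorem continuousOn_arcsineCDF_one_sub_div {α : ℝ} (hα : α ∈ Ioo (0:ℝ) 1) :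
    ContinuousOn (fun x => arcsineCDF α ((1 - x) / x)) (Ioc (0:ℝ) 1) :=
  (((continuousOn_integral_arcsineKernel hα).mono Ioc_subset_Icc_self).const_mul _).congr
    fun _ hx => arcsineCDF_one_sub_div hx.1

theorem integrableOn_arcsineCDF_one_sub_div {α : ℝ} (hα : α ∈ Ioo (0:ℝ) 1) :
    IntegrableOn (fun x => arcsineCDF α ((1 - x) / x)) (Ioo (0:ℝ) 1) := by
  have := ((continuousOn_integral_arcsineKernel hα).integrableOn_Icc (μ := volume)).mono_set
    Ioo_subset_Icc_self
  exact IntegrableOn.congr_fun (this.const_mul (Real.sin (Real.pi * α) / Real.pi))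
    (fun x hx => (arcsineCDF_one_sub_div hx.1).symm) measurableSet_Ioo

theorem integrableOn_antitoneOn_one_sub_div {Λ : ℝ → ℝ}
    (hrange : ∀ u : ℝ, 0 ≤ u → Λ u ∈ Icc (0:ℝ) 1) (hanti : AntitoneOn Λ (Ici (0:ℝ))) :
    IntegrableOn (fun x => Λ ((1 - x) / x)) (Ioo (0:ℝ) 1) := by
  have hnn : ∀ x ∈ Ioo (0:ℝ) 1, 0 ≤ (1 - x) / x :=
    fun x hx => div_nonneg (sub_nonneg.2 hx.2.le) hx.1.le
  have hmono : MonotoneOn (fun x => Λ ((1 - x) / x)) (Ioo (0:ℝ) 1) := by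
    intro x hx y hy hxy
    refine hanti (hnn y hy) (hnn x hx) ?_
    rw [div_le_div_iff₀ hy.1 hx.1]
    nlinarith
  refine Integrable.of_bound (C := 1)
    (aemeasurable_restrict_of_monotoneOn measurableSet_Ioo hmono).aestronglyMeasurable ?_
  filter_upwards [ae_restrict_mem measurableSet_Ioo] with x hx
  have := hrange _ (hnn x hx)
  rw [Real.norm_of_nonneg this.1]
  exact this.2

/-- A left limit of a function vanishing a.e. on `(0, 1)` is zero. -/
theorem eq_zero_of_tendsto_of_ae_eq_zero {D : ℝ → ℝ}
    (hD : ∀ᵐ x, x ∈ Ioo (0:ℝ) 1 → D x = 0) {x : ℝ} (hx : x ∈ Ioc (0:ℝ) 1) {l : ℝ}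
    (hlim : Tendsto D (nhdsWithin x (Iio x)) (nhds l)) : l = 0 := by
  by_contra hl
  have hev := hlim.eventually_ne hl
  obtain ⟨a, ha, hsub⟩ := (mem_nhdsLT_iff_exists_Ioo_subset' hx.1).1
    (hev.and (Ioo_mem_nhdsLT hx.1))
  have hnull : volume (Ioo a x) = 0 := by
    refine measure_mono_null (t := {y | ¬(y ∈ Ioo (0:ℝ) 1 → D y = 0)}) (fun y hy hy' => ?_) hD
    have := hsub hy
    exact this.1 (hy' ⟨this.2.1, this.2.2.trans_le hx.2⟩)
  rw [Real.volume_Ioo, ENNReal.ofReal_eq_zero] at hnull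
  linarith [show a < x from ha]

theorem stmt_16 (α : ℝ) (hα : α ∈ Set.Ioo (0:ℝ) 1) (Λ : ℝ → ℝ)
    (hrange : ∀ u : ℝ, 0 ≤ u → Λ u ∈ Set.Icc (0:ℝ) 1)
    (hanti : AntitoneOn Λ (Set.Ici (0:ℝ)))
    (hrc : ∀ u : ℝ, 0 ≤ u → ContinuousWithinAt Λ (Set.Ici u) u)
    (heq : ∀ θ : ℝ, 0 < θ →
      (∫ t in Set.Ioi (0:ℝ), ((1 + t) ^ 2)⁻¹ * Λ (θ * t)) = cFun α θ) :
    ∀ u : ℝ, 0 ≤ u → Λ u = arcsineCDF α u := by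
  have hΛ := integrableOn_antitoneOn_one_sub_div hrange hanti
  have hA := integrableOn_arcsineCDF_one_sub_div hα
  have htrans : ∀ ε < 1, ∫ x in Ioo (0:ℝ) 1,
      (Λ ((1 - x) / x) - arcsineCDF α ((1 - x) / x)) * ((1 - ε * x) ^ 2)⁻¹ = 0 := by
    intro ε hε
    have hθ : 0 < 1 - ε := sub_pos.2 hε
    have h1 := heq _ hθ
    have hi1 := integrableOn_mul_inv_sq hθ hΛ
    have hi2 := integrableOn_mul_inv_sq hθ hA
    rw [integral_Ioi_eq_integral_Ioo_unit hθ, ← integral_arcsineCDF_mul_inv_sq hα hθ] at h1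
    have h2 := mul_left_cancel₀ hθ.ne' h1
    simp only [sub_sub_cancel] at h2 hi1 hi2
    simp only [sub_mul]
    rw [integral_sub hi1 hi2, h2, sub_self]
  have hae := ae_eq_zero_of_integral_mul_pow_eq_zero (hΛ.sub hA)
    (integral_mul_pow_eq_zero_of_transform_eq_zero (hΛ.sub hA) htrans)
  intro u hu
  set x : ℝ := 1 / (1 + u) with hxdef
  have hx : x ∈ Ioc (0:ℝ) 1 := ⟨by positivity, by rw [hxdef, div_le_one (by positivity)]; linarith⟩
  have hxu : (1 - x) / x = u := by
    rw [hxdef]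
    field_simp
    ring
  have hlimΛ : Tendsto (fun y => Λ ((1 - y) / y)) (nhdsWithin x (Iio x)) (nhds (Λ u)) := by
    refine (hrc u hu).tendsto.comp (tendsto_nhdsWithin_iff.2 ⟨?_, ?_⟩)
    · have : ContinuousAt (fun y : ℝ => (1 - y) / y) x :=
        ContinuousAt.div (by fun_prop) (by fun_prop) hx.1.ne'
      simpa only [hxu] using this.tendsto.mono_left nhdsWithin_le_nhds
    · filter_upwards [Ioo_mem_nhdsLT hx.1] with y hy
      rw [mem_Ici, ← hxu, div_le_div_iff₀ hx.1 hy.1]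
      nlinarith [hy.2]
  have hlimA : Tendsto (fun y => arcsineCDF α ((1 - y) / y)) (nhdsWithin x (Iio x))
      (nhds (arcsineCDF α u)) := by
    have := (continuousOn_arcsineCDF_one_sub_div hα x hx).tendsto
    simp only [hxu] at this
    refine this.mono_left ?_
    rw [← nhdsWithin_Ioo_eq_nhdsLT hx.1]
    exact nhdsWithin_mono _ fun y hy => ⟨hy.1, hy.2.le.trans hx.2⟩
  exact sub_eq_zero.1 (eq_zero_of_tendsto_of_ae_eq_zero hae hx (hlimΛ.sub hlimA))
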